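/- Exact branch factorization for width-2 path families: Let m ≥ 2 and let F ⊆ 𝒫_m be any subset of the width-2 path family. Define F₀′ = {τ a permutation of Fin (m−1) : the permutation σ of Fin m given by σ(0) = 0 and σ(i+1) = τ(i)+1 belongs to F}, and F₁′ = {τ a permutation of Fin (m−2) : the permutation σ of Fin m given by σ(0) = 1, σ(1) = 0 and σ(i+2) = τ(i)+2 belongs to F}. Then, in ℚ[λ], P_F(λ) = (∏_{i=1}^{m−1} (λ + i)) · P_{F₀′}(λ + 1) − λ · (∏_{i=2}^{m−1} (λ + i)²) · P_{F₁′}(λ + 2), where P_{F₀′}(λ+1) and P_{F₁′}(λ+2) denote the Vandermonde polynomials of F₀′ and F₁′ with argument shifted by 1 and 2 respectively. -/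

import Mathlib

open Polynomial

/-- The Vandermonde polynomial of a finite family of permutations of `Fin n`. -/
noncomputable def vand {n : ℕ} (F : Finset (Equiv.Perm (Fin n))) : Polynomial ℚ :=
  ∑ σ ∈ F, Polynomial.C ((Equiv.Perm.sign σ : ℤ) : ℚ) *
    ∏ i : Fin n, (Polynomial.X + Polynomial.C ((i : ℚ))) ^ ((σ i : ℕ))

/-- The width-2 path family `𝒫_m = {σ ∈ S_m : |σ(i) − i| ≤ 1 for all i}`. -/
def pathFam (m : ℕ) : Finset (Equiv.Perm (Fin m)) :=
  Finset.univ.filter (fun σ => ∀ i, |((σ i : ℕ) : ℤ) - ((i : ℕ) : ℤ)| ≤ 1)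

/-- The extension of a permutation of `Fin n` to `Fin (n + 1)` fixing `0`. -/
def extendFix {n : ℕ} (τ : Equiv.Perm (Fin n)) : Equiv.Perm (Fin (n + 1)) :=
  Equiv.Perm.decomposeFin.symm (0, τ)

/-- The extension of a permutation of `Fin n` to `Fin (n + 2)` exchanging `0` and `1`. -/
def extendSwap {n : ℕ} (τ : Equiv.Perm (Fin n)) : Equiv.Perm (Fin (n + 2)) :=
  Equiv.Perm.decomposeFin.symm (1, extendFix τ)

section extensions

variable {n : ℕ}

@[simp]
theorem extendFix_zero (τ : Equiv.Perm (Fin n)) : extendFix τ 0 = 0 := by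
  simp [extendFix]

@[simp]
theorem extendFix_succ (τ : Equiv.Perm (Fin n)) (i : Fin n) :
    extendFix τ i.succ = (τ i).succ := by
  simp [extendFix]

@[simp]
theorem sign_extendFix (τ : Equiv.Perm (Fin n)) :
    Equiv.Perm.sign (extendFix τ) = Equiv.Perm.sign τ := by
  simp [extendFix]

theorem extendFix_injective : Function.Injective (extendFix (n := n)) := fun a b h => by
  simpa [extendFix] using h

@[simp]
theorem extendSwap_zero (τ : Equiv.Perm (Fin n)) : extendSwap τ 0 = 1 := by
  simp [extendSwap]

@[simp]
theorem extendSwap_one (τ : Equiv.Perm (Fin n)) : extendSwap τ 1 = 0 := by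
  simp [extendSwap]

@[simp]
theorem extendSwap_succ_succ (τ : Equiv.Perm (Fin n)) (i : Fin n) :
    extendSwap τ i.succ.succ = (τ i).succ.succ := by
  rw [extendSwap, Equiv.Perm.decomposeFin_symm_apply_succ, extendFix_succ]
  exact Equiv.swap_apply_of_ne_of_ne (Fin.succ_ne_zero _) (by simp [Fin.ext_iff])

@[simp]
theorem sign_extendSwap (τ : Equiv.Perm (Fin n)) :
    Equiv.Perm.sign (extendSwap τ) = -Equiv.Perm.sign τ := by
  simp [extendSwap]

theorem extendSwap_injective : Function.Injective (extendSwap (n := n)) := fun a b h =>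
  extendFix_injective (by simpa [extendSwap] using h)

theorem eq_extendFix_iff (σ : Equiv.Perm (Fin (n + 1))) (τ : Equiv.Perm (Fin n)) :
    σ = extendFix τ ↔ σ 0 = 0 ∧ ∀ i : Fin n, σ i.succ = (τ i).succ := by
  simp [Equiv.ext_iff, Fin.forall_fin_succ]

theorem eq_extendSwap_iff (σ : Equiv.Perm (Fin (n + 2))) (τ : Equiv.Perm (Fin n)) :
    σ = extendSwap τ ↔ σ 0 = 1 ∧ σ 1 = 0 ∧ ∀ i : Fin n, σ i.succ.succ = (τ i).succ.succ := by
  simp [Equiv.ext_iff, Fin.forall_fin_succ]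

theorem exists_extendFix_eq {σ : Equiv.Perm (Fin (n + 1))} (h : σ 0 = 0) :
    ∃ τ, extendFix τ = σ := by
  obtain ⟨⟨p, τ⟩, rfl⟩ := Equiv.Perm.decomposeFin.symm.surjective σ
  obtain rfl : p = 0 := by simpa using h
  exact ⟨τ, rfl⟩

theorem exists_extendSwap_eq {σ : Equiv.Perm (Fin (n + 2))} (h₀ : σ 0 = 1) (h₁ : σ 1 = 0) :
    ∃ τ, extendSwap τ = σ := by
  obtain ⟨⟨p, ρ⟩, rfl⟩ := Equiv.Perm.decomposeFin.symm.surjective σ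
  obtain rfl : p = 1 := by simpa using h₀
  have hρ : ρ 0 = 0 := by
    rw [← Fin.succ_zero_eq_one, Equiv.Perm.decomposeFin_symm_apply_succ,
      Equiv.swap_apply_eq_iff, Equiv.swap_apply_left] at h₁
    exact Fin.succ_injective _ h₁
  obtain ⟨τ, rfl⟩ := exists_extendFix_eq hρ
  exact ⟨τ, rfl⟩

/-- A permutation in the path family either fixes `0` or exchanges `0` and `1`. -/
theorem apply_zero_one_of_mem_pathFam {σ : Equiv.Perm (Fin (n + 2))} (hσ : σ ∈ pathFam (n + 2))
    (h : σ 0 ≠ 0) : σ 0 = 1 ∧ σ 1 = 0 := by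
  simp only [pathFam, Finset.mem_filter, Finset.mem_univ, true_and] at hσ
  have eq_one (j : Fin (n + 2)) (hj : j ≠ 0) (hle : |(j : ℤ)| ≤ 1) : j = 1 := by
    simp only [ne_eq, Fin.ext_iff, Fin.val_zero, Fin.val_one, Nat.abs_cast] at *
    omega
  refine ⟨eq_one _ h (by simpa using hσ 0), ?_⟩
  have hj : σ.symm 0 ≠ 0 := fun hz => h (by rw [← hz, Equiv.apply_symm_apply, hz])
  rw [← eq_one _ hj (by simpa using hσ (σ.symm 0)), Equiv.apply_symm_apply]

end extensions

/-- The signed monomial product contributed by one permutation to `vand`. -/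
noncomputable def vandTerm {n : ℕ} (σ : Equiv.Perm (Fin n)) : Polynomial ℚ :=
  C ((Equiv.Perm.sign σ : ℤ) : ℚ) * ∏ i : Fin n, (X + C ((i : ℚ))) ^ ((σ i : ℕ))

theorem vandTerm_extendFix {n : ℕ} (τ : Equiv.Perm (Fin n)) :
    vandTerm (extendFix τ) =
      (∏ i ∈ Finset.Icc 1 n, (X + C ((i : ℚ)))) * (vandTerm τ).comp (X + C 1) := by
  have hprod : ∏ i ∈ Finset.Icc 1 n, (X + C (i : ℚ)) =
      ∏ i : Fin n, (X + C ((i : ℚ) + 1)) := by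
    rw [← Finset.Ico_add_one_right_eq_Icc, Finset.prod_Ico_eq_prod_range, Finset.prod_range]
    simp [add_comm]
  rw [hprod]
  simp only [vandTerm, sign_extendFix, Fin.prod_univ_succ, extendFix_zero, extendFix_succ,
    mul_comp, prod_comp, pow_comp, add_comp, X_comp, C_comp, Fin.val_zero, pow_zero, one_mul,
    Fin.val_succ, pow_succ, Finset.prod_mul_distrib, Nat.cast_add, Nat.cast_one, add_assoc,
    ← C_add, add_comm (1 : ℚ)]
  ring

theorem vandTerm_extendSwap {n : ℕ} (τ : Equiv.Perm (Fin n)) :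
    vandTerm (extendSwap τ) =
      -(X * (∏ i ∈ Finset.Icc 2 (n + 1), (X + C ((i : ℚ))) ^ 2) *
        (vandTerm τ).comp (X + C 2)) := by
  have hprod : ∏ i ∈ Finset.Icc 2 (n + 1), (X + C (i : ℚ)) ^ 2 =
      ∏ i : Fin n, (X + C ((i : ℚ) + 2)) ^ 2 := by
    rw [← Finset.Ico_add_one_right_eq_Icc, Finset.prod_Ico_eq_prod_range,
      show n + 1 + 1 - 2 = n from rfl, Finset.prod_range]
    simp [add_comm]
  rw [hprod]
  simp only [vandTerm, sign_extendSwap, Fin.prod_univ_succ, extendSwap_zero,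
    Fin.succ_zero_eq_one, extendSwap_one, extendSwap_succ_succ,
    mul_comp, prod_comp, pow_comp, add_comp, X_comp, C_comp, Fin.val_zero, Fin.val_one,
    pow_zero, pow_one, one_mul, Fin.val_succ, add_assoc, one_add_one_eq_two, pow_add,
    Finset.prod_mul_distrib, Nat.cast_add, Nat.cast_one, Nat.cast_zero, C_0, add_zero,
    ← C_add, add_comm (2 : ℚ), Units.val_neg, Int.cast_neg, C_neg]
  ring

/-- Exact branch factorization for width-2 path families (stated for `m + 2 ≥ 2`):
`P_F(λ) = (∏_{i=1}^{m−1}(λ+i)) · P_{F₀′}(λ+1) − λ · (∏_{i=2}^{m−1}(λ+i)²) · P_{F₁′}(λ+2)`,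
where `F₀′` collects the `τ` with the extension `σ(0)=0, σ(i+1)=τ(i)+1` in `F`, and `F₁′`
collects the `τ` with the extension `σ(0)=1, σ(1)=0, σ(i+2)=τ(i)+2` in `F`. -/
theorem width2_path_branch_factorization (m : ℕ)
    (F : Finset (Equiv.Perm (Fin (m + 2)))) (hF : F ⊆ pathFam (m + 2)) :
    vand F
      = (∏ i ∈ Finset.Icc 1 (m + 1), (Polynomial.X + Polynomial.C ((i : ℚ)))) *
          ((vand (Finset.univ.filter (fun τ : Equiv.Perm (Fin (m + 1)) =>
              ∃ σ ∈ F, σ 0 = 0 ∧ ∀ i : Fin (m + 1), σ i.succ = (τ i).succ))).comp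
            (Polynomial.X + Polynomial.C 1))
        - Polynomial.X *
          (∏ i ∈ Finset.Icc 2 (m + 1), (Polynomial.X + Polynomial.C ((i : ℚ))) ^ 2) *
          ((vand (Finset.univ.filter (fun τ : Equiv.Perm (Fin m) =>
              ∃ σ ∈ F, σ 0 = 1 ∧ σ 1 = 0 ∧
                ∀ i : Fin m, σ i.succ.succ = ((τ i).succ).succ))).comp
            (Polynomial.X + Polynomial.C 2)) := by
  have hfix : Finset.univ.filter (fun τ : Equiv.Perm (Fin (m + 1)) =>
      ∃ σ ∈ F, σ 0 = 0 ∧ ∀ i : Fin (m + 1), σ i.succ = (τ i).succ) =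
      Finset.univ.filter (fun τ => extendFix τ ∈ F) := by
    simp [← eq_extendFix_iff]
  have hswap : Finset.univ.filter (fun τ : Equiv.Perm (Fin m) =>
      ∃ σ ∈ F, σ 0 = 1 ∧ σ 1 = 0 ∧ ∀ i : Fin m, σ i.succ.succ = ((τ i).succ).succ) =
      Finset.univ.filter (fun τ => extendSwap τ ∈ F) := by
    simp [← eq_extendSwap_iff]
  have vand_eq {n : ℕ} (G : Finset (Equiv.Perm (Fin n))) : vand G = ∑ σ ∈ G, vandTerm σ := rfl
  rw [hfix, hswap, vand_eq, vand_eq, vand_eq, sum_comp, sum_comp,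
    Finset.mul_sum, Finset.mul_sum, sub_eq_add_neg, ← Finset.sum_neg_distrib]
  simp only [← vandTerm_extendFix, ← vandTerm_extendSwap]
  rw [← Finset.sum_filter_add_sum_filter_not F (fun σ => σ 0 = 0)]
  congr 1
  · symm
    refine Finset.sum_bij (fun τ _ => extendFix τ) (by simp)
      (fun _ _ _ _ h => extendFix_injective h) (fun σ hσ => ?_) (fun _ _ => rfl)
    obtain ⟨hσF, h₀⟩ := Finset.mem_filter.mp hσ
    obtain ⟨τ, rfl⟩ := exists_extendFix_eq h₀
    exact ⟨τ, by simpa using hσF, rfl⟩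
  · symm
    refine Finset.sum_bij (fun τ _ => extendSwap τ) (by simp)
      (fun _ _ _ _ h => extendSwap_injective h) (fun σ hσ => ?_) (fun _ _ => rfl)
    obtain ⟨hσF, h₀⟩ := Finset.mem_filter.mp hσ
    obtain ⟨h₀, h₁⟩ := apply_zero_one_of_mem_pathFam (hF hσF) h₀
    obtain ⟨τ, rfl⟩ := exists_extendSwap_eq h₀ h₁
    exact ⟨τ, by simpa using hσF, rfl⟩
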